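/- Let p ∈ [3,5), M > 0, and suppose C₁, C_{1/2} > 0 are constants such that for every Schwartz function v : ℝ → ℂ one has ∫_ℝ|v|^{p+1} ≤ C₁ (∫_ℝ|v|²)^{(p+3)/4} (∫_ℝ|v′|²)^{(p−1)/4} and ∫_ℝ|v|^{p+1} ≤ C_{1/2} (∫_ℝ|v|²) (∫_ℝ 2π|ξ| |v̂(ξ)|² dξ)^{(p−1)/2}; set α = (2^{3(p+1)/2}/(p+1)) max{C₁, C_{1/2}}. Let c ≥ max{ (αM)^{(p−1)/(5−p)}, (α^{4/(p+3)}M)^{(p−1)/(5−p)} }. Then for every Schwartz function u : ℝ → ℂ with 𝓜(u) = M and 𝓔_c(u) < 0, either K_c(u) > c^{(p+3)/(p−1)} or K_c(u) ≤ α^{4/(5−p)} M^{(p+3)/(5−p)}. -/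

import Mathlib

open Real MeasureTheory SchwartzMap FourierTransform

/-- The symbol of the pseudo-relativistic operator. -/
noncomputable def mSym (c ξ : ℝ) : ℝ := Real.sqrt (c ^ 2 * ξ ^ 2 + c ^ 4 / 4) - c ^ 2 / 2

/-- The mass `𝓜(u)`. -/
noncomputable def massOf (u : ℝ → ℂ) : ℝ := ∫ x : ℝ, ‖u x‖ ^ 2

/-- The relativistic kinetic energy `K_c(u)`. -/
noncomputable def kineticC (c : ℝ) (u : ℝ → ℂ) : ℝ :=
  ∫ ξ : ℝ, mSym c (2 * π * ξ) * ‖𝓕 u ξ‖ ^ 2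

/-- The relativistic energy `𝓔_c(u)`. -/
noncomputable def energyC (c p : ℝ) (u : ℝ → ℂ) : ℝ :=
  (1 / 2) * kineticC c u - (1 / (p + 1)) * ∫ x : ℝ, ‖u x‖ ^ (p + 1)

theorem mSym_nonneg' (c x : ℝ) : 0 ≤ mSym c x := by
  unfold mSym
  have : c ^ 2 / 2 ≤ Real.sqrt (c ^ 2 * x ^ 2 + c ^ 4 / 4) := by
    apply Real.le_sqrt_of_sq_le
    nlinarith [mul_nonneg (sq_nonneg c) (sq_nonneg x)]
  linarith

theorem mSym_low (c x : ℝ) (hc : 0 < c) (hx : |x| ≤ 2 * c) : x ^ 2 ≤ 4 * mSym c x := by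
  unfold mSym
  have hx2 : x ^ 2 ≤ 4 * c ^ 2 := by
    rw [← sq_abs]; nlinarith [abs_nonneg x]
  have : c ^ 2 / 2 + x ^ 2 / 4 ≤ Real.sqrt (c ^ 2 * x ^ 2 + c ^ 4 / 4) := by
    apply Real.le_sqrt_of_sq_le
    nlinarith [mul_nonneg (sq_nonneg c) (sq_nonneg x), mul_nonneg (sub_nonneg.2 hx2) (sq_nonneg x)]
  linarith

theorem mSym_high (c x : ℝ) (hc : 0 < c) (hx : c ≤ |x|) : |x| ≤ 2 / c * mSym c x := by
  unfold mSym
  have : c ^ 2 / 2 + c * |x| / 2 ≤ Real.sqrt (c ^ 2 * x ^ 2 + c ^ 4 / 4) := by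
    apply Real.le_sqrt_of_sq_le
    rw [← sq_abs x]
    have : 0 ≤ c ^ 2 * |x| * (|x| - c) := by
      have := sub_nonneg.2 hx
      positivity
    nlinarith [mul_nonneg (sq_nonneg c) (sq_nonneg |x|)]
  rw [div_mul_eq_mul_div, le_div_iff₀ hc]
  nlinarith

theorem mSym_upper (c x : ℝ) (hc : 0 < c) : mSym c x ≤ c * |x| := by
  unfold mSym
  have : Real.sqrt (c ^ 2 * x ^ 2 + c ^ 4 / 4) ≤ c * |x| + c ^ 2 / 2 := by
    apply Real.sqrt_le_iff.2
    refine ⟨by positivity, ?_⟩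
    rw [← sq_abs x]
    have : 0 ≤ c ^ 3 * |x| := by positivity
    nlinarith
  linarith

theorem integrable_pow_sq (f : SchwartzMap ℝ ℂ) (k : ℕ) :
    Integrable (fun x : ℝ => |x| ^ k * ‖f x‖ ^ 2) := by
  obtain ⟨C, _, hC⟩ := f.decay 0 0
  have h := f.integrable_pow_mul volume k
  refine (h.const_mul C).mono' (by have := f.continuous; fun_prop) (ae_of_all _ fun x => ?_)
  have h1 : ‖f x‖ ≤ C := by simpa using hC x
  rw [Real.norm_of_nonneg (by positivity), Real.norm_eq_abs]
  have : 0 ≤ |x| ^ k * ‖f x‖ := by positivity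
  nlinarith

theorem integrable_rpow' (f : SchwartzMap ℝ ℂ) (q : ℝ) (hq : 0 < q) :
    Integrable (fun x : ℝ => ‖f x‖ ^ q) := by
  have h := (f.memLp (ENNReal.ofReal q)).integrable_norm_rpow (by simpa using hq) (by simp)
  simpa [ENNReal.toReal_ofReal hq.le] using h

theorem integrable_kin (c : ℝ) (hc : 0 < c) (f : SchwartzMap ℝ ℂ) :
    Integrable (fun x : ℝ => mSym c (2 * π * x) * ‖f x‖ ^ 2) := by
  refine ((integrable_pow_sq f 1).const_mul (c * (2 * π))).mono' ?_ (ae_of_all _ fun x => ?_)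
  · unfold mSym
    have := f.continuous
    fun_prop
  · rw [Real.norm_of_nonneg (mul_nonneg (mSym_nonneg' _ _) (by positivity))]
    have := mSym_upper c (2 * π * x) hc
    rw [abs_mul, abs_of_pos (by positivity : 0 < 2 * π)] at this
    calc _ ≤ (c * (2 * π * |x|)) * ‖f x‖ ^ 2 := by gcongr
      _ = _ := by ring

theorem add_rpow_le' (a b q : ℝ) (ha : 0 ≤ a) (hb : 0 ≤ b) (hq : 1 ≤ q) :
    (a + b) ^ q ≤ 2 ^ (q - 1) * (a ^ q + b ^ q) := by
  have := NNReal.rpow_add_le_mul_rpow_add_rpow ⟨a, ha⟩ ⟨b, hb⟩ hq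
  exact_mod_cast this

theorem cutoff_exists (c : ℝ) (hc : 0 < c) (u : SchwartzMap ℝ ℂ) :
    ∃ v : SchwartzMap ℝ ℂ, ∃ φ : ℝ → ℝ, (∀ x, 0 ≤ φ x ∧ φ x ≤ 1) ∧
      (∀ x, |2 * π * x| ≤ c → φ x = 1) ∧ (∀ x, 2 * c ≤ |2 * π * x| → φ x = 0) ∧
      (∀ x, 𝓕 (v : ℝ → ℂ) x = φ x * 𝓕 (u : ℝ → ℂ) x) := by
  have h2 : 0 < 2 * π := by positivity
  let φ : ContDiffBump (0 : ℝ) := ⟨c / (2 * π), 2 * c / (2 * π), by positivity, by gcongr; linarith⟩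
  have hg : (fun x => (φ x : ℂ)).HasTemperateGrowth := by
    apply HasCompactSupport.hasTemperateGrowth
    · exact φ.hasCompactSupport.comp_left (g := fun r : ℝ => (r : ℂ)) (by simp)
    · exact Complex.ofRealCLM.contDiff.comp φ.contDiff
  refine ⟨𝓕⁻ (SchwartzMap.smulLeftCLM ℂ (fun x => (φ x : ℂ)) (𝓕 u)), φ,
    fun x => ⟨φ.nonneg, φ.le_one⟩, fun x hx => ?_, fun x hx => ?_, fun x => ?_⟩
  · apply φ.one_of_mem_closedBall
    rw [abs_mul, abs_of_pos h2] at hx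
    simp only [Metric.mem_closedBall, dist_zero_right, Real.norm_eq_abs, φ]
    rw [le_div_iff₀ h2]; linarith
  · apply φ.zero_of_le_dist
    rw [abs_mul, abs_of_pos h2] at hx
    simp only [dist_zero_right, Real.norm_eq_abs, φ]
    rw [div_le_iff₀ h2]; linarith
  · rw [← SchwartzMap.fourier_coe, FourierTransform.fourier_fourierInv_eq,
      SchwartzMap.smulLeftCLM_apply_apply hg, smul_eq_mul, SchwartzMap.fourier_coe]

theorem deriv_plancherel (v : SchwartzMap ℝ ℂ) :
    ∫ x : ℝ, ‖deriv (⇑v) x‖ ^ 2 = ∫ x : ℝ, (2 * π * x) ^ 2 * ‖𝓕 (⇑v) x‖ ^ 2 := by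
  have h := SchwartzMap.integral_norm_sq_fourier (SchwartzMap.derivCLM ℂ ℂ v)
  simp only [SchwartzMap.derivCLM_apply] at h
  rw [← h]
  congr 1; ext x
  have e : ⇑(SchwartzMap.derivCLM ℂ ℂ v) = deriv v := by
    ext x; exact SchwartzMap.derivCLM_apply ℂ v x
  rw [SchwartzMap.fourier_coe, e,
    Real.fourier_deriv v.integrable v.differentiable (by rw [← e]; exact SchwartzMap.integrable _)]
  simp [mul_pow, abs_of_pos Real.pi_pos]

theorem final_alg (p M α c K : ℝ) (hp3 : 3 ≤ p) (hp5 : p < 5) (hM : 0 < M) (hα : 0 < α)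
    (hc0 : 0 < c) (hc : (α * M) ^ ((p - 1) / (5 - p)) ≤ c) (hK0 : 0 < K)
    (hK : K < α / 2 * (M ^ ((p + 3) / 4) * K ^ ((p - 1) / 4) + M * (K / c) ^ ((p - 1) / 2))) :
    c ^ ((p + 3) / (p - 1)) < K ∨ K ≤ α ^ (4 / (5 - p)) * M ^ ((p + 3) / (5 - p)) := by
  have h5 : 0 < 5 - p := by linarith
  have h1 : 0 < p - 1 := by linarith
  rcases le_total (M * (K / c) ^ ((p - 1) / 2)) (M ^ ((p + 3) / 4) * K ^ ((p - 1) / 4)) with h | h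
  · right
    have h2 : K ≤ α * M ^ ((p + 3) / 4) * K ^ ((p - 1) / 4) := by nlinarith
    have h3 : K ^ ((5 - p) / 4) ≤ α * M ^ ((p + 3) / 4) := by
      have : K = K ^ ((5 - p) / 4) * K ^ ((p - 1) / 4) := by
        rw [← Real.rpow_add hK0]
        rw [show (5 - p) / 4 + (p - 1) / 4 = 1 by ring, Real.rpow_one]
      have hp : 0 < K ^ ((p - 1) / 4) := by positivity
      refine le_of_mul_le_mul_right ?_ hp
      rw [← this]; exact h2
    have h4 := Real.rpow_le_rpow (by positivity) h3 (by positivity : 0 ≤ 4 / (5 - p))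
    rw [← Real.rpow_mul hK0.le, Real.mul_rpow hα.le (by positivity), ← Real.rpow_mul hM.le] at h4
    rw [show (5 - p) / 4 * (4 / (5 - p)) = 1 by field_simp, Real.rpow_one,
      show (p + 3) / 4 * (4 / (5 - p)) = (p + 3) / (5 - p) by field_simp] at h4
    exact h4
  · left
    by_contra hcon
    push Not at hcon
    have h2 : K < α * M * (K / c) ^ ((p - 1) / 2) := by nlinarith
    rw [Real.div_rpow hK0.le hc0.le] at h2
    have hs : K ^ ((p - 1) / 2) = K * K ^ ((p - 3) / 2) := by
      nth_rw 2 [← Real.rpow_one K]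
      rw [← Real.rpow_add hK0]; congr 1; ring
    have hcp : 0 < c ^ ((p - 1) / 2) := by positivity
    have h3 : c ^ ((p - 1) / 2) < α * M * K ^ ((p - 3) / 2) := by
      rw [hs, mul_div_assoc', lt_div_iff₀ hcp] at h2
      refine lt_of_mul_lt_mul_left ?_ hK0.le
      linarith
    have h4 : K ^ ((p - 3) / 2) ≤ c ^ ((p + 3) / (p - 1) * ((p - 3) / 2)) := by
      rw [Real.rpow_mul hc0.le]
      exact Real.rpow_le_rpow hK0.le hcon (by linarith)
    have h5' : c ^ ((p - 1) / 2) =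
        c ^ ((5 - p) / (p - 1)) * c ^ ((p + 3) / (p - 1) * ((p - 3) / 2)) := by
      rw [← Real.rpow_add hc0]; congr 1; field_simp; ring
    have h6 : α * M ≤ c ^ ((5 - p) / (p - 1)) := by
      have := Real.rpow_le_rpow (by positivity) hc (by positivity : 0 ≤ (5 - p) / (p - 1))
      rw [← Real.rpow_mul (by positivity),
        show (p - 1) / (5 - p) * ((5 - p) / (p - 1)) = 1 by field_simp, Real.rpow_one] at this
      exact this
    have h7 : α * M * K ^ ((p - 3) / 2) ≤ c ^ ((p - 1) / 2) := by
      rw [h5']; gcongr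
    linarith

theorem separation_of_negative_energy (p M : ℝ) (hp3 : 3 ≤ p) (hp5 : p < 5) (hM : 0 < M)
    (C₁ Chalf : ℝ) (hC₁ : 0 < C₁) (hChalf : 0 < Chalf)
    (hGN1 : ∀ v : SchwartzMap ℝ ℂ,
      (∫ x : ℝ, ‖v x‖ ^ (p + 1))
        ≤ C₁ * (∫ x : ℝ, ‖v x‖ ^ 2) ^ ((p + 3) / 4)
            * (∫ x : ℝ, ‖deriv (⇑v) x‖ ^ 2) ^ ((p - 1) / 4))
    (hGN2 : ∀ v : SchwartzMap ℝ ℂ,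
      (∫ x : ℝ, ‖v x‖ ^ (p + 1))
        ≤ Chalf * (∫ x : ℝ, ‖v x‖ ^ 2)
            * (∫ ξ : ℝ, 2 * π * |ξ| * ‖𝓕 (⇑v) ξ‖ ^ 2) ^ ((p - 1) / 2))
    (α : ℝ) (hα : α = 2 ^ (3 * (p + 1) / 2) / (p + 1) * max C₁ Chalf)
    (c : ℝ)
    (hc : max ((α * M) ^ ((p - 1) / (5 - p))) ((α ^ (4 / (p + 3)) * M) ^ ((p - 1) / (5 - p))) ≤ c) :
    ∀ u : SchwartzMap ℝ ℂ, massOf (⇑u) = M → energyC c p (⇑u) < 0 →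
      c ^ ((p + 3) / (p - 1)) < kineticC c (⇑u) ∨
        kineticC c (⇑u) ≤ α ^ (4 / (5 - p)) * M ^ ((p + 3) / (5 - p)) := by
  intro u hu hE
  have hm : 0 < max C₁ Chalf := lt_max_of_lt_left hC₁
  have hα0 : 0 < α := by
    rw [hα]
    have : 0 < p + 1 := by linarith
    positivity
  have hc1 := (le_max_left _ _).trans hc
  have hc0 : 0 < c := lt_of_lt_of_le (by positivity) hc1
  have hint : Integrable (fun x : ℝ => mSym c (2 * π * x) * ‖𝓕 (⇑u) x‖ ^ 2) := by
    simpa only [SchwartzMap.fourier_coe] using integrable_kin c hc0 (𝓕 u)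
  have hKnn : 0 ≤ kineticC c u :=
    integral_nonneg fun x => mul_nonneg (mSym_nonneg' _ _) (by positivity)
  rcases hKnn.eq_or_lt with h0 | hK0
  · right; rw [← h0]; positivity
  have key : (∫ x : ℝ, ‖u x‖ ^ (p + 1)) ≤ 2 ^ p * (max C₁ Chalf * 2 ^ ((p - 1) / 2) *
      (M ^ ((p + 3) / 4) * kineticC c u ^ ((p - 1) / 4) +
        M * (kineticC c u / c) ^ ((p - 1) / 2))) := by
    obtain ⟨v, φ, hφ, hφ1, hφ0, hv⟩ := cutoff_exists c hc0 u
    obtain ⟨w, hw⟩ : ∃ w, w = u - v := ⟨_, rfl⟩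
    have hwF : ∀ x, 𝓕 (⇑w) x = ((1 - φ x : ℝ) : ℂ) * 𝓕 (⇑u) x := by
      intro x
      have : 𝓕 w = 𝓕 u - 𝓕 v := by
        rw [hw]; exact map_sub (SchwartzMap.fourierTransformCLM ℂ) u v
      rw [← SchwartzMap.fourier_coe, this, sub_apply, SchwartzMap.fourier_coe,
        SchwartzMap.fourier_coe, hv]
      push_cast; ring
    have hnv : ∀ x, ‖𝓕 (⇑v) x‖ ^ 2 ≤ ‖𝓕 (⇑u) x‖ ^ 2 := by
      intro x
      rw [hv, norm_mul, Complex.norm_real, Real.norm_of_nonneg (hφ x).1]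
      refine pow_le_pow_left₀ (by have := hφ x; exact mul_nonneg (by linarith) (norm_nonneg _)) ?_ 2
      exact mul_le_of_le_one_left (norm_nonneg _) (hφ x).2
    have hnw : ∀ x, ‖𝓕 (⇑w) x‖ ^ 2 ≤ ‖𝓕 (⇑u) x‖ ^ 2 := by
      intro x
      rw [hwF, norm_mul, Complex.norm_real, Real.norm_of_nonneg (by linarith [(hφ x).2])]
      refine pow_le_pow_left₀ (by have := hφ x; exact mul_nonneg (by linarith) (norm_nonneg _)) ?_ 2
      exact mul_le_of_le_one_left (norm_nonneg _) (by linarith [(hφ x).1])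
    have hsq : ∀ f : SchwartzMap ℝ ℂ, Integrable (fun x => ‖𝓕 (⇑f) x‖ ^ 2) := by
      intro f
      simpa [SchwartzMap.fourier_coe] using integrable_pow_sq (𝓕 f) 0
    have hmass : ∀ f : SchwartzMap ℝ ℂ, (∀ x, ‖𝓕 (⇑f) x‖ ^ 2 ≤ ‖𝓕 (⇑u) x‖ ^ 2) →
        ∫ x : ℝ, ‖f x‖ ^ 2 ≤ M := by
      intro f hf
      rw [← hu, massOf, ← SchwartzMap.integral_norm_sq_fourier f,
        ← SchwartzMap.integral_norm_sq_fourier u]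
      simp only [SchwartzMap.fourier_coe]
      exact integral_mono (hsq f) (hsq u) hf
    have hdv : ∫ x : ℝ, ‖deriv (⇑v) x‖ ^ 2 ≤ 4 * kineticC c u := by
      rw [deriv_plancherel, kineticC, ← integral_const_mul]
      refine integral_mono_of_nonneg (ae_of_all _ fun x => by positivity) (hint.const_mul 4)
        (ae_of_all _ fun x => ?_)
      dsimp only
      rcases le_total (2 * c) |2 * π * x| with h | h
      · rw [hv, hφ0 x h]
        have := mul_nonneg (mSym_nonneg' c (2 * π * x)) (sq_nonneg ‖𝓕 (⇑u) x‖)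
        simpa using this
      · rw [← mul_assoc]
        exact mul_le_mul (mSym_low c _ hc0 h) (hnv x) (by positivity)
          (mul_nonneg (by norm_num) (mSym_nonneg' _ _))
    have hdw : ∫ x : ℝ, 2 * π * |x| * ‖𝓕 (⇑w) x‖ ^ 2 ≤ 2 * (kineticC c u / c) := by
      rw [show 2 * (kineticC c u / c) = 2 / c * kineticC c u by ring, kineticC,
        ← integral_const_mul]
      refine integral_mono_of_nonneg (ae_of_all _ fun x => by positivity) (hint.const_mul (2 / c))
        (ae_of_all _ fun x => ?_)
      dsimp only
      have e : 2 * π * |x| = |2 * π * x| := by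
        rw [abs_mul, abs_of_pos (by positivity : 0 < 2 * π)]
      rw [e]
      rcases le_total |2 * π * x| c with h | h
      · rw [hwF, hφ1 x h]
        have := mul_nonneg (mSym_nonneg' c (2 * π * x)) (sq_nonneg ‖𝓕 (⇑u) x‖)
        have := mul_nonneg (by positivity : 0 ≤ 2 / c) this
        simpa using this
      · rw [← mul_assoc]
        exact mul_le_mul (mSym_high c _ hc0 h) (hnw x) (by positivity)
          (mul_nonneg (by positivity) (mSym_nonneg' _ _))
    have g1 : (∫ x : ℝ, ‖v x‖ ^ (p + 1)) ≤ max C₁ Chalf * M ^ ((p + 3) / 4) *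
        (4 * kineticC c u) ^ ((p - 1) / 4) := by
      refine (hGN1 v).trans ?_
      gcongr
      · exact le_max_left _ _
      · exact hmass v hnv
      · linarith
    have g2 : (∫ x : ℝ, ‖w x‖ ^ (p + 1)) ≤ max C₁ Chalf * M *
        (2 * (kineticC c u / c)) ^ ((p - 1) / 2) := by
      refine (hGN2 w).trans ?_
      gcongr
      · exact le_max_right _ _
      · exact hmass w hnw
      · linarith
    have i1 := integrable_rpow' v (p + 1) (by linarith)
    have i2 := integrable_rpow' w (p + 1) (by linarith)
    have g3 : (∫ x : ℝ, ‖u x‖ ^ (p + 1)) ≤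
        2 ^ p * ((∫ x : ℝ, ‖v x‖ ^ (p + 1)) + ∫ x : ℝ, ‖w x‖ ^ (p + 1)) := by
      rw [← integral_add i1 i2, ← integral_const_mul]
      refine integral_mono (integrable_rpow' u (p + 1) (by linarith))
        ((i1.add i2).const_mul _) fun x => ?_
      have e : u x = v x + w x := by rw [hw]; simp
      have := add_rpow_le' ‖v x‖ ‖w x‖ (p + 1) (norm_nonneg _) (norm_nonneg _) (by linarith)
      rw [add_sub_cancel_right] at this
      refine le_trans ?_ this
      dsimp only
      rw [e]
      exact Real.rpow_le_rpow (norm_nonneg _) (norm_add_le _ _) (by linarith)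
    refine g3.trans ?_
    gcongr
    refine (add_le_add g1 g2).trans (le_of_eq ?_)
    rw [Real.mul_rpow (by norm_num) hKnn, Real.mul_rpow (by norm_num) (by positivity),
      show (4 : ℝ) = 2 ^ (2 : ℝ) by norm_num, ← Real.rpow_mul (by norm_num)]
    norm_num
    rw [show 2 * ((p - 1) / 4) = (p - 1) / 2 by ring]
    ring
  refine final_alg p M α c _ hp3 hp5 hM hα0 hc0 hc1 hK0 ?_
  unfold energyC at hE
  have hp1 : 0 < p + 1 := by linarith
  have h2 : kineticC c u < 2 / (p + 1) * ∫ x : ℝ, ‖u x‖ ^ (p + 1) := by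
    have : 2 / (p + 1) * ∫ x : ℝ, ‖u x‖ ^ (p + 1)
      = 2 * (1 / (p + 1) * ∫ x : ℝ, ‖u x‖ ^ (p + 1)) := by ring
    linarith
  refine h2.trans_le ((mul_le_mul_of_nonneg_left key (by positivity)).trans (le_of_eq ?_))
  rw [hα, show 3 * (p + 1) / 2 = 1 + 1 + p + (p - 1) / 2 by ring,
    Real.rpow_add (by norm_num), Real.rpow_add (by norm_num), Real.rpow_add (by norm_num),
    Real.rpow_one]
  ring
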